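/- Let R be a commutative ring and let 𝒜 ⊆ Spec(R) be a chain (totally ordered by inclusion). Then 𝒜 is compact in the Zariski topology if and only if 𝒜 has the prime avoidance property for R. In particular, if 𝒜 is compact then ⋃_{P∈𝒜} P belongs to 𝒜. -/

import Mathlib

theorem chain_max_of_compact {R : Type*} [CommRing R] (A : Set (PrimeSpectrum R))
    (hchain : IsChain (fun P Q : PrimeSpectrum R => P.asIdeal ≤ Q.asIdeal) A)
    (hne : A.Nonempty) (hc : IsCompact A) :
    ∃ P ∈ A, ∀ Q ∈ A, Q.asIdeal ≤ P.asIdeal := by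
  by_contra! hcon
  have : Nonempty A := hne.to_subtype
  obtain ⟨i, hi⟩ := hc.elim_directed_family_closed
    (fun Q : A => PrimeSpectrum.zeroLocus (Q.1.asIdeal : Set R))
    (fun Q => PrimeSpectrum.isClosed_zeroLocus _)
    (by
      ext P
      simp only [Set.mem_inter_iff, Set.mem_iInter, Set.mem_empty_iff_false, iff_false, not_and]
      intro hP h
      obtain ⟨Q, hQ, hn⟩ := hcon P hP
      exact hn (h ⟨Q, hQ⟩))
    (by
      intro P Q
      have : P.1.asIdeal ≤ Q.1.asIdeal ∨ Q.1.asIdeal ≤ P.1.asIdeal := by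
        by_cases h : P.1 = Q.1
        · left; rw [h]
        · exact hchain P.2 Q.2 h
      rcases this with h | h
      · exact ⟨Q, PrimeSpectrum.zeroLocus_anti_mono h, subset_rfl⟩
      · exact ⟨P, subset_rfl, PrimeSpectrum.zeroLocus_anti_mono h⟩)
  have : i.1 ∈ (∅ : Set (PrimeSpectrum R)) := hi ▸ ⟨i.2, fun _ hx => hx⟩
  exact this

/-- for a chain `𝒜 ⊆ Spec R` (totally ordered by inclusion), `𝒜` is
compact iff it has the prime avoidance property for `R`; and in particular if `𝒜` is
compact (and nonempty) then the union of the members of `𝒜` belongs to `𝒜`. -/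
theorem chain_compact_iff_prime_avoidance
    {R : Type*} [CommRing R] (𝒜 : Set (PrimeSpectrum R))
    (hchain : IsChain (fun P Q : PrimeSpectrum R => P.asIdeal ≤ Q.asIdeal) 𝒜) :
    (IsCompact 𝒜 ↔
      ∀ I : Ideal R, (I : Set R) ⊆ ⋃ P ∈ 𝒜, (P.asIdeal : Set R) →
        ∃ P ∈ 𝒜, I ≤ P.asIdeal) ∧
    (𝒜.Nonempty → IsCompact 𝒜 →
      ∃ P ∈ 𝒜, (⋃ Q ∈ 𝒜, (Q.asIdeal : Set R)) = (P.asIdeal : Set R)) := by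
  have key : 𝒜.Nonempty → IsCompact 𝒜 →
      ∃ P ∈ 𝒜, (⋃ Q ∈ 𝒜, (Q.asIdeal : Set R)) = (P.asIdeal : Set R) := by
    intro hne hc
    obtain ⟨P, hP, h⟩ := chain_max_of_compact 𝒜 hchain hne hc
    exact ⟨P, hP, Set.Subset.antisymm (Set.iUnion₂_subset h)
      (Set.subset_biUnion_of_mem (u := fun Q : PrimeSpectrum R => (Q.asIdeal : Set R)) hP)⟩
  refine ⟨⟨?_, ?_⟩, key⟩
  · intro hc I hI
    have hne : 𝒜.Nonempty := by
      have := hI I.zero_mem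
      simp only [Set.mem_iUnion] at this
      obtain ⟨P, hP, _⟩ := this
      exact ⟨P, hP⟩
    obtain ⟨P, hP, h⟩ := key hne hc
    exact ⟨P, hP, fun x hx => by
      have := hI hx
      rw [h] at this
      exact this⟩
  · intro h
    rcases 𝒜.eq_empty_or_nonempty with rfl | hne
    · exact isCompact_empty
    have : Nonempty 𝒜 := hne.to_subtype
    have hdir : Directed (· ≤ ·) (fun Q : 𝒜 => Q.1.asIdeal) := by
      intro P Q
      have : P.1.asIdeal ≤ Q.1.asIdeal ∨ Q.1.asIdeal ≤ P.1.asIdeal := by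
        by_cases h : P.1 = Q.1
        · left; rw [h]
        · exact hchain P.2 Q.2 h
      rcases this with h | h
      · exact ⟨Q, h, le_rfl⟩
      · exact ⟨P, le_rfl, h⟩
    obtain ⟨P, hP, hmax⟩ := h (⨆ Q : 𝒜, Q.1.asIdeal) (by
      intro x hx
      obtain ⟨Q, hQ⟩ := (Submodule.mem_iSup_of_directed _ hdir).1 hx
      exact Set.mem_biUnion Q.2 hQ)
    apply isCompact_of_finite_subcover
    intro ι U hU hcov
    obtain ⟨i, hi⟩ := Set.mem_iUnion.1 (hcov hP)
    refine ⟨{i}, fun Q hQ => ?_⟩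
    simp only [Finset.mem_singleton, Set.iUnion_iUnion_eq_left]
    have hle : Q ≤ P := (le_iSup (fun Q : 𝒜 => Q.1.asIdeal) ⟨Q, hQ⟩).trans hmax
    exact ((PrimeSpectrum.le_iff_specializes Q P).1 hle).mem_open (hU i) hi
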